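/- Let n ≥ 1 and let P be a finite poset with Aut(P) cyclic of order n, generated by g. If 3 exactly divides n and 4 exactly divides n, then Σ_{α ∈ g} (4·w₄(α) + 3·w₃(α)) ≥ 20, where the sum ranges over all cycles α of g. -/

import Mathlib

/-- A prime power `q = p^r` exactly divides `n` if `q ∣ n` and `p^(r+1) = q * p ∤ n`. -/
def ExactDvd (q n : ℕ) : Prop := q ∣ n ∧ ¬ (q * q.minFac ∣ n)

/-- The orbit of `x` under the cyclic group generated by the automorphism `g`. -/
def orbit {P : Type} [PartialOrder P] (g : P ≃o P) (x : P) : Set P :=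
  {y | ∃ m : ℤ, (g ^ m) x = y}

/-- The cycles of the automorphism `g`: the orbits of `⟨g⟩` of cardinality at least `2`. -/
def cycles {P : Type} [PartialOrder P] (g : P ≃o P) : Set (Set P) :=
  {A | (∃ x : P, A = orbit g x) ∧ 2 ≤ A.ncard}

open scoped Classical

/-- The weight `w_q(α)` of the prime power `q` in a cycle `α` of length `l`, for a
generator of a cyclic automorphism group of order `n`.  Any weight not explicitly
assigned is `0`.
* Exception 6 (`l = 6`): if `3 ∥ n` then `w₃ = 2`; else if `2 ∥ n` then `w₂ = 3`;
  else `w₄ = 3/2`.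
* Exception 12 (`l = 12`): if `3 ∥ n` then `w₃ = 4`; else `w₄ = 3`.
* Exception 10-14 (`l = 2p`, `p = 5, 7`): if `2 ∥ n` then `w₂ = 1`, otherwise
  `w₄ = 1/2`; in either case `w_p = 2(p-1)/p`.
* General case (`l = p₁^{r₁}⋯p_k^{r_k} ∉ {6,10,12,14}`): `w_{p_i^{r_i}} = (l/p_i^{r_i})/k`,
  except that if `p_i^{r_i} = 2` and `2 ∦ n` then `w₂ = 0` and `w₄ = (l/2)/(2k)`. -/
noncomputable def w (n l q : ℕ) : ℚ :=
  if l = 6 then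
    (if ExactDvd 3 n then (if q = 3 then 2 else 0)
     else if ExactDvd 2 n then (if q = 2 then 3 else 0)
     else (if q = 4 then 3/2 else 0))
  else if l = 12 then
    (if ExactDvd 3 n then (if q = 3 then 4 else 0)
     else (if q = 4 then 3 else 0))
  else if l = 10 then
    (if q = 5 then 8/5
     else if ExactDvd 2 n then (if q = 2 then 1 else 0)
     else (if q = 4 then 1/2 else 0))
  else if l = 14 then
    (if q = 7 then 12/7
     else if ExactDvd 2 n then (if q = 2 then 1 else 0)
     else (if q = 4 then 1/2 else 0))
  else
    if IsPrimePow q ∧ ExactDvd q l ∧ ¬ (q = 2 ∧ ¬ ExactDvd 2 n) then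
      ((l : ℚ) / q) / (l.primeFactors.card : ℚ)
    else if q = 4 ∧ ¬ ExactDvd 2 n ∧ ExactDvd 2 l then
      ((l : ℚ) / 2) / (2 * (l.primeFactors.card : ℚ))
    else 0


section Orbits

variable {P : Type} [PartialOrder P] {g : P ≃o P} {x y : P}

theorem zpow_add_apply (g : P ≃o P) (i j : ℤ) (x : P) :
    (g ^ (i + j)) x = (g ^ i) ((g ^ j) x) := by
  rw [zpow_add, RelIso.mul_apply]

theorem zpow_le_zpow_iff (g : P ≃o P) (k : ℤ) (x y : P) :
    (g ^ k) x ≤ (g ^ k) y ↔ x ≤ y :=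
  (g ^ k).le_iff_le

/-- Only the difference of the exponents matters in a comparison. -/
theorem zpow_le_zpow_iff_sub (g : P ≃o P) (i j : ℤ) (x y : P) :
    (g ^ i) x ≤ (g ^ j) y ↔ x ≤ (g ^ (j - i)) y := by
  rw [← zpow_le_zpow_iff g i x, ← zpow_add_apply, add_sub_cancel]

theorem zpow_le_iff (g : P ≃o P) (i : ℤ) (x y : P) :
    (g ^ i) x ≤ y ↔ x ≤ (g ^ (-i)) y := by
  simpa using zpow_le_zpow_iff_sub g i 0 x y

theorem mem_orbit_self (g : P ≃o P) (x : P) : x ∈ orbit g x := ⟨0, by simp⟩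

theorem zpow_mem_orbit (g : P ≃o P) (k : ℤ) (x : P) : (g ^ k) x ∈ orbit g x := ⟨k, rfl⟩

theorem orbit_zpow (g : P ≃o P) (k : ℤ) (x : P) : orbit g ((g ^ k) x) = orbit g x := by
  ext z
  constructor
  · rintro ⟨m, rfl⟩
    exact ⟨m + k, zpow_add_apply ..⟩
  · rintro ⟨m, rfl⟩
    exact ⟨m - k, by rw [← zpow_add_apply, sub_add_cancel]⟩

theorem orbit_eq_iff : orbit g y = orbit g x ↔ y ∈ orbit g x := by
  constructor
  · intro h
    exact h ▸ mem_orbit_self g y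
  · rintro ⟨m, rfl⟩
    exact orbit_zpow g m x

theorem mem_orbit_comm : y ∈ orbit g x ↔ x ∈ orbit g y := by
  rw [← orbit_eq_iff, ← orbit_eq_iff, eq_comm]

theorem zpow_mem_orbit_iff (k : ℤ) : (g ^ k) y ∈ orbit g x ↔ y ∈ orbit g x := by
  rw [← orbit_eq_iff, ← orbit_eq_iff, orbit_zpow]

theorem zpow_eq_self_iff (g : P ≃o P) (k : ℤ) (x : P) :
    (g ^ k) x = x ↔ ((orbit g x).ncard : ℤ) ∣ k := by
  have h : orbit g x = MulAction.orbit (Subgroup.zpowers g) x := by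
    ext z
    constructor
    · rintro ⟨m, rfl⟩
      exact ⟨⟨g ^ m, m, rfl⟩, rfl⟩
    · rintro ⟨⟨_, m, rfl⟩, rfl⟩
      exact ⟨m, rfl⟩
  rw [h, ← Nat.card_coe_set_eq, Nat.card_congr (MulAction.orbitZPowersEquiv g x), Nat.card_zmod,
    ← MulAction.zpow_smul_eq_iff_minimalPeriod_dvd]
  rfl

theorem zpow_eq_zpow_iff (g : P ≃o P) (i j : ℤ) (x : P) :
    (g ^ i) x = (g ^ j) x ↔ ((orbit g x).ncard : ℤ) ∣ i - j := by
  rw [← zpow_eq_self_iff, ← (g ^ (-j)).injective.eq_iff, ← zpow_add_apply, ← zpow_add_apply,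
    neg_add_cancel, zpow_zero, RelIso.one_apply, neg_add_eq_sub]

theorem ncard_orbit_dvd_orderOf (g : P ≃o P) (x : P) : (orbit g x).ncard ∣ orderOf g := by
  have h : (g ^ (orderOf g : ℤ)) x = x := by simp [pow_orderOf_eq_one]
  exact_mod_cast (zpow_eq_self_iff g _ x).1 h

theorem ncard_orbit_pos [Finite P] (g : P ≃o P) (x : P) : 0 < (orbit g x).ncard :=
  (Set.ncard_pos (Set.toFinite _)).2 ⟨x, mem_orbit_self g x⟩

/-- Orbits of an automorphism of a finite poset are antichains. -/
theorem eq_of_mem_orbit_of_le [Finite P] (hy : y ∈ orbit g x) (hle : x ≤ y) : x = y := by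
  obtain ⟨k, rfl⟩ := hy
  have hmono : ∀ m : ℕ, (g ^ k) x ≤ (g ^ (k * (m + 1 : ℕ))) x := by
    intro m
    induction m with
    | zero => simp
    | succ m ih =>
      refine ih.trans ?_
      have := (zpow_le_zpow_iff g (k * (m + 1 : ℕ)) _ _).2 hle
      rw [← zpow_add_apply] at this
      convert this using 3
      push_cast
      ring
  have hpos := ncard_orbit_pos g x
  have h1 := hmono ((orbit g x).ncard - 1)
  rw [Nat.sub_add_cancel hpos, (zpow_eq_self_iff g _ x).2 (dvd_mul_left _ _)] at h1
  exact le_antisymm hle h1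

theorem exists_zpow_eq_and_fix {i j : ℤ} (v : P)
    (hk : (Nat.gcd (orbit g x).ncard (orbit g v).ncard : ℤ) ∣ i - j) :
    ∃ b : ℤ, (g ^ i) x = (g ^ b) ((g ^ j) x) ∧ (g ^ b) v = v := by
  obtain ⟨c, hc⟩ := hk
  rw [Nat.gcd_eq_gcd_ab] at hc
  refine ⟨(orbit g v).ncard * (Nat.gcdB (orbit g x).ncard (orbit g v).ncard * c), ?_,
    (zpow_eq_self_iff ..).2 (dvd_mul_right ..)⟩
  rw [← zpow_add_apply, zpow_eq_zpow_iff]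
  exact ⟨Nat.gcdA (orbit g x).ncard (orbit g v).ncard * c, by linear_combination hc⟩

/-- Comparability of two points is invariant under moving one of them by a multiple of the
greatest common divisor of the two orbit sizes. -/
theorem zpow_le_iff_of_gcd_dvd {i j : ℤ} (v : P)
    (hk : (Nat.gcd (orbit g x).ncard (orbit g v).ncard : ℤ) ∣ i - j) :
    (g ^ i) x ≤ v ↔ (g ^ j) x ≤ v := by
  obtain ⟨b, hx, hv⟩ := exists_zpow_eq_and_fix v hk
  rw [← zpow_le_zpow_iff g b ((g ^ j) x), hv, hx]

theorem le_zpow_iff_of_gcd_dvd {i j : ℤ} (v : P)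
    (hk : (Nat.gcd (orbit g x).ncard (orbit g v).ncard : ℤ) ∣ i - j) :
    v ≤ (g ^ i) x ↔ v ≤ (g ^ j) x := by
  obtain ⟨b, hx, hv⟩ := exists_zpow_eq_and_fix v hk
  rw [← zpow_le_zpow_iff g b v ((g ^ j) x), hv, hx]

theorem exists_eq_zpow_of_involutive (hgen : ∀ φ : P ≃o P, ∃ m : ℤ, g ^ m = φ)
    {φ : P → P} (hinv : Function.Involutive φ) (hmono : Monotone φ) :
    ∃ m : ℤ, ∀ u, φ u = (g ^ m) u := by
  have hle : ∀ {a b : P}, hinv.toPerm φ a ≤ hinv.toPerm φ b ↔ a ≤ b := fun {a b} =>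
    ⟨fun h => hinv a ▸ hinv b ▸ hmono h, fun h => hmono h⟩
  obtain ⟨m, hm⟩ := hgen ⟨hinv.toPerm φ, hle⟩
  exact ⟨m, fun u => by rw [hm]; rfl⟩

/-- A transposition inside an orbit of size at least three cannot be an automorphism. -/
theorem false_of_swap [Finite P] (hgen : ∀ φ : P ≃o P, ∃ m : ℤ, g ^ m = φ) {k : ℤ}
    (hx : 3 ≤ (orbit g x).ncard) (hk : ¬ ((orbit g x).ncard : ℤ) ∣ k)
    (hrel : ∀ v ∉ orbit g x, (Nat.gcd (orbit g x).ncard (orbit g v).ncard : ℤ) ∣ k) : False := by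
  set x' := (g ^ k) x
  have hne : x' ≠ x := fun h => hk ((zpow_eq_self_iff g k x).1 h)
  have hmem : x' ∈ orbit g x := zpow_mem_orbit g k x
  have key : ∀ u ∈ ({x, x'} : Set P), ∀ v ∉ orbit g x, ((u ≤ v ↔ x ≤ v) ∧ (v ≤ u ↔ v ≤ x)) := by
    rintro u (rfl | rfl) v hv
    · simp
    · have h0 := (sub_zero k).symm ▸ hrel v hv
      simpa using And.intro (zpow_le_iff_of_gcd_dvd v h0) (le_zpow_iff_of_gcd_dvd v h0)
  have hmono : Monotone (Equiv.swap x x') := by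
    intro u v huv
    by_cases hu : u ∈ ({x, x'} : Set P)
    · have huo : u ∈ orbit g x := by rcases hu with rfl | rfl <;> simp [mem_orbit_self, hmem]
      by_cases hv : v ∈ orbit g x
      · rw [eq_of_mem_orbit_of_le (orbit_eq_iff.2 huo ▸ hv) huv]
      · have hsv : Equiv.swap x x' v = v := Equiv.swap_apply_of_ne_of_ne
          (fun h => hv (h ▸ mem_orbit_self g x)) (fun h => hv (h ▸ hmem))
        have hsu : Equiv.swap x x' u ∈ ({x, x'} : Set P) := by
          rcases hu with rfl | rfl <;> simp
        rw [hsv, (key _ hsu v hv).1]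
        exact (key _ hu v hv).1.1 huv
    · have hsu : Equiv.swap x x' u = u := Equiv.swap_apply_of_ne_of_ne
          (fun h => hu (by simp [h])) (fun h => hu (by simp [h]))
      by_cases hv : v ∈ ({x, x'} : Set P)
      · have hvo : v ∈ orbit g x := by rcases hv with rfl | rfl <;> simp [mem_orbit_self, hmem]
        by_cases hu' : u ∈ orbit g x
        · rw [eq_of_mem_orbit_of_le (orbit_eq_iff.2 hu' ▸ hvo) huv]
        · have hsv : Equiv.swap x x' v ∈ ({x, x'} : Set P) := by
            rcases hv with rfl | rfl <;> simp
          rw [hsu, (key _ hsv u hu').2]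
          exact (key _ hv u hu').2.1 huv
      · have hsv : Equiv.swap x x' v = v := Equiv.swap_apply_of_ne_of_ne
          (fun h => hv (by simp [h])) (fun h => hv (by simp [h]))
        rwa [hsu, hsv]
  obtain ⟨m, hm⟩ := exists_eq_zpow_of_involutive hgen (Equiv.swap_apply_self x x') hmono
  obtain ⟨z, hz, hz'⟩ : ∃ z ∈ orbit g x, z ∉ ({x, x'} : Set P) := by
    by_contra! h
    have := (Set.ncard_le_ncard h).trans (Set.ncard_pair hne.symm).le
    omega
  have h1 : (g ^ m) z = z := by
    rw [← hm]
    exact Equiv.swap_apply_of_ne_of_ne (fun h => hz' (by simp [h])) (fun h => hz' (by simp [h]))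
  have h2 : (g ^ m) x = x' := by rw [← hm, Equiv.swap_apply_left]
  rw [zpow_eq_self_iff, orbit_eq_iff.2 hz, ← zpow_eq_self_iff, h2] at h1
  exact hne h1

/-- If `p ^ r ∣ l` but `p ^ r ∤ d` for a divisor `d` of `l`, then `d ∣ l / p`. -/
theorem dvd_div_of_not_dvd {p r l d : ℕ} (hp : p.Prime) (hl : p ^ r ∣ l) (hd : d ∣ l)
    (hdq : ¬ p ^ r ∣ d) : d ∣ l / p := by
  obtain ⟨e, rfl⟩ := hd
  by_cases hpe : p ∣ e
  · obtain ⟨f, rfl⟩ := hpe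
    exact ⟨f, Nat.div_eq_of_eq_mul_left hp.pos (by ring)⟩
  · exact absurd
      ((Nat.Coprime.pow_left r ((Nat.Prime.coprime_iff_not_dvd hp).2 hpe)).dvd_of_dvd_mul_right hl)
      hdq

/-- A prime power greater than two dividing some orbit size divides the size of a second orbit. -/
theorem exists_not_mem_orbit_dvd_ncard [Finite P] (hgen : ∀ φ : P ≃o P, ∃ m : ℤ, g ^ m = φ)
    {p r : ℕ} (hp : p.Prime) (hr : 3 ≤ p ^ r) (hx : p ^ r ∣ (orbit g x).ncard) :
    ∃ y ∉ orbit g x, p ^ r ∣ (orbit g y).ncard := by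
  by_contra! h
  have hpos := ncard_orbit_pos g x
  have hpd : p ∣ (orbit g x).ncard := (dvd_pow_self p (by rintro rfl; simp at hr)).trans hx
  refine false_of_swap (k := ((orbit g x).ncard / p : ℕ)) hgen (hr.trans (Nat.le_of_dvd hpos hx))
    ?_ fun v hv => ?_
  · norm_cast
    exact Nat.not_dvd_of_pos_of_lt (Nat.div_pos (Nat.le_of_dvd hpos hpd) hp.pos)
      (Nat.div_lt_self hpos hp.one_lt)
  · norm_cast
    exact dvd_div_of_not_dvd hp hx (Nat.gcd_dvd_left ..)
      fun hd => h v hv (hd.trans (Nat.gcd_dvd_right ..))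

/-- A prime power dividing the order of `g` divides the size of some orbit. -/
theorem exists_dvd_ncard_orbit [Finite P] {p r : ℕ} (hp : p.Prime) (hr : r ≠ 0)
    (h : p ^ r ∣ orderOf g) (hpos : 0 < orderOf g) : ∃ x : P, p ^ r ∣ (orbit g x).ncard := by
  by_contra! hno
  have hpd : p ∣ orderOf g := (dvd_pow_self p hr).trans h
  have : g ^ (orderOf g / p) = 1 := by
    ext x
    have := (zpow_eq_self_iff g (orderOf g / p : ℕ) x).2 (by
      exact_mod_cast dvd_div_of_not_dvd hp h (ncard_orbit_dvd_orderOf g x) (hno x))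
    rwa [zpow_natCast] at this
  have h1 := Nat.le_of_dvd (Nat.div_pos (Nat.le_of_dvd hpos hpd) hp.pos)
    (orderOf_dvd_of_pow_eq_one this)
  exact absurd (Nat.div_lt_self hpos hp.one_lt) (by omega)

/-- Suppose that two orbits are permuted by involutions of the form `gⁱ x ↦ g ^ (f i) x` and
`gʲ y ↦ g ^ (h j) y`, compatibly with all order relations. Then the resulting automorphism of `P`
is a power of `g`. -/
theorem exists_zpow_of_twist [Finite P] (hgen : ∀ φ : P ≃o P, ∃ m : ℤ, g ^ m = φ)
    (hyx : y ∉ orbit g x) {f h : ℤ → ℤ}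
    (hf : ∀ i j, (g ^ i) x = (g ^ j) x → (g ^ f i) x = (g ^ f j) x)
    (hff : ∀ i, (g ^ f (f i)) x = (g ^ i) x)
    (hh : ∀ i j, (g ^ i) y = (g ^ j) y → (g ^ h i) y = (g ^ h j) y)
    (hhh : ∀ i, (g ^ h (h i)) y = (g ^ i) y)
    (hx : ∀ v ∉ orbit g x, v ∉ orbit g y → ∀ i,
      ((g ^ i) x ≤ v → (g ^ f i) x ≤ v) ∧ (v ≤ (g ^ i) x → v ≤ (g ^ f i) x))
    (hy : ∀ v ∉ orbit g x, v ∉ orbit g y → ∀ i,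
      ((g ^ i) y ≤ v → (g ^ h i) y ≤ v) ∧ (v ≤ (g ^ i) y → v ≤ (g ^ h i) y))
    (hxy : ∀ i j, ((g ^ i) x ≤ (g ^ j) y → (g ^ f i) x ≤ (g ^ h j) y) ∧
      ((g ^ j) y ≤ (g ^ i) x → (g ^ h j) y ≤ (g ^ f i) x)) :
    ∃ m : ℤ, ∀ i, (g ^ f i) x = (g ^ (m + i)) x := by
  let φ : P → P := fun u =>
    if hu : u ∈ orbit g x then (g ^ f hu.choose) x
    else if hu' : u ∈ orbit g y then (g ^ h hu'.choose) y else u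
  have φx : ∀ i, φ ((g ^ i) x) = (g ^ f i) x := by
    intro i
    have hi := zpow_mem_orbit g i x
    simp only [φ, hi, dif_pos]
    exact hf _ _ hi.choose_spec
  have φy : ∀ i, φ ((g ^ i) y) = (g ^ h i) y := by
    intro i
    have hi := zpow_mem_orbit g i y
    have hi' : (g ^ i) y ∉ orbit g x := by rwa [zpow_mem_orbit_iff]
    simp only [φ, hi, hi', dif_pos, dif_neg, not_false_eq_true]
    exact hh _ _ hi.choose_spec
  have φv : ∀ v ∉ orbit g x, v ∉ orbit g y → φ v = v := by
    intro v h1 h2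
    simp only [φ, h1, h2, dif_neg, not_false_eq_true]
  have hinv : Function.Involutive φ := by
    intro u
    by_cases hux : u ∈ orbit g x
    · obtain ⟨i, rfl⟩ := hux
      rw [φx, φx, hff]
    by_cases huy : u ∈ orbit g y
    · obtain ⟨i, rfl⟩ := huy
      rw [φy, φy, hhh]
    rw [φv u hux huy, φv u hux huy]
  have hmono : Monotone φ := by
    intro u v huv
    by_cases huv' : v ∈ orbit g u
    · rw [eq_of_mem_orbit_of_le huv' huv]
    by_cases hux : u ∈ orbit g x
    · obtain ⟨i, rfl⟩ := hux
      rw [orbit_zpow] at huv'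
      by_cases hvy : v ∈ orbit g y
      · obtain ⟨j, rfl⟩ := hvy
        rw [φx, φy]
        exact (hxy i j).1 huv
      · rw [φx, φv v huv' hvy]
        exact (hx v huv' hvy i).1 huv
    by_cases huy : u ∈ orbit g y
    · obtain ⟨j, rfl⟩ := huy
      rw [orbit_zpow] at huv'
      by_cases hvx : v ∈ orbit g x
      · obtain ⟨i, rfl⟩ := hvx
        rw [φx, φy]
        exact (hxy i j).2 huv
      · rw [φy, φv v hvx huv']
        exact (hy v hvx huv' j).1 huv
    rw [φv u hux huy]
    by_cases hvx : v ∈ orbit g x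
    · obtain ⟨i, rfl⟩ := hvx
      rw [φx]
      exact (hx u hux huy i).2 huv
    by_cases hvy : v ∈ orbit g y
    · obtain ⟨j, rfl⟩ := hvy
      rw [φy]
      exact (hy u hux huy j).2 huv
    rwa [φv v hvx hvy]
  obtain ⟨m, hm⟩ := exists_eq_zpow_of_involutive hgen hinv hmono
  exact ⟨m, fun i => by rw [← φx, hm, zpow_add_apply]⟩

/-- The special case of `exists_zpow_of_twist` in which both orbits are reflected; the second one
is reflected in a factor `ℤ/q` selected by the idempotent `e`. -/
theorem false_of_reflection [Finite P] (hgen : ∀ φ : P ≃o P, ∃ m : ℤ, g ^ m = φ)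
    (hyx : y ∉ orbit g x) (hq : 3 ≤ (orbit g x).ncard) {c d e : ℤ}
    (he : ((orbit g y).ncard : ℤ) ∣ e * (1 - e))
    (hx : ∀ v ∉ orbit g x, v ∉ orbit g y → ∀ i,
      ((g ^ i) x ≤ v → (g ^ (c - i)) x ≤ v) ∧ (v ≤ (g ^ i) x → v ≤ (g ^ (c - i)) x))
    (hy : ∀ v ∉ orbit g x, v ∉ orbit g y → ∀ i,
      ((g ^ i) y ≤ v → (g ^ (i + e * (d - 2 * i))) y ≤ v) ∧
        (v ≤ (g ^ i) y → v ≤ (g ^ (i + e * (d - 2 * i))) y))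
    (hxy : ∀ i j,
      ((g ^ i) x ≤ (g ^ j) y → (g ^ (c - i)) x ≤ (g ^ (j + e * (d - 2 * j))) y) ∧
        ((g ^ j) y ≤ (g ^ i) x → (g ^ (j + e * (d - 2 * j))) y ≤ (g ^ (c - i)) x)) :
    False := by
  obtain ⟨m, hm⟩ := exists_zpow_of_twist hgen hyx (f := fun i => c - i)
    (h := fun j => j + e * (d - 2 * j))
    (by
      simp only [zpow_eq_zpow_iff]
      rintro i j ⟨t, ht⟩
      exact ⟨-t, by linear_combination -ht⟩)
    (by simp)
    (by
      simp only [zpow_eq_zpow_iff]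
      rintro i j ⟨t, ht⟩
      exact ⟨t * (1 - 2 * e), by linear_combination (1 - 2 * e) * ht⟩)
    (by
      simp only [zpow_eq_zpow_iff]
      intro i
      obtain ⟨t, ht⟩ := he
      exact ⟨t * (2 * (d - 2 * i)), by linear_combination (2 * (d - 2 * i)) * ht⟩)
    hx hy hxy
  have h0 := (zpow_eq_zpow_iff ..).1 (hm 0)
  have h1 := (zpow_eq_zpow_iff ..).1 (hm 1)
  have h2 : ((orbit g x).ncard : ℤ) ∣ 2 := by
    obtain ⟨⟨s, hs⟩, t, ht⟩ := And.intro h0 h1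
    exact ⟨s - t, by linear_combination hs - ht⟩
  have := Int.le_of_dvd (by norm_num) h2
  omega

/-- Every subset of `ℤ/3` is symmetric under some reflection. -/
theorem exists_reflection_zmod_three (p : ZMod 3 → Prop) : ∃ c, ∀ k, p k → p (c - k) := by
  have : ∀ p : ZMod 3 → Bool, ∃ c, ∀ k, p k → p (c - k) := by decide
  simpa using this fun k => decide (p k)

/-- A subset of `ℤ/4` is symmetric under an even reflection, unless it consists of two
consecutive elements. -/
theorem exists_reflection_zmod_four (p : ZMod 4 → Prop) :
    (∃ c, ∀ k, p k → p (2 * c - k)) ∨ ∃ s, ∀ k, p k ↔ k = s ∨ k = s + 1 := by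
  have : ∀ p : ZMod 4 → Bool,
      (∃ c, ∀ k, p k → p (2 * c - k)) ∨ ∃ s, ∀ k, p k ↔ k = s ∨ k = s + 1 := by decide
  simpa using this fun k => decide (p k)

theorem not_le_zpow_of_zpow_le [Finite P] (hyx : y ∉ orbit g x) {i : ℤ} (h : (g ^ i) y ≤ x)
    (j : ℤ) : ¬ x ≤ (g ^ j) y := by
  intro h'
  have hmem : (g ^ j) y ∈ orbit g ((g ^ i) y) := by
    rw [orbit_zpow]
    exact zpow_mem_orbit ..
  have := eq_of_mem_orbit_of_le hmem (h.trans h')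
  have hx : x = (g ^ j) y := le_antisymm h' (this ▸ h)
  exact hyx (mem_orbit_comm.1 (hx ▸ zpow_mem_orbit ..))

theorem exists_intCast_pred {q : ℕ} {R : ℤ → Prop}
    (hR : ∀ i j : ℤ, (q : ℤ) ∣ i - j → (R i ↔ R j)) : ∃ p : ZMod q → Prop, ∀ k : ℤ, p k ↔ R k := by
  refine ⟨fun k => ∃ j : ℤ, (j : ZMod q) = k ∧ R j, fun k => ⟨?_, fun h => ⟨k, rfl, h⟩⟩⟩
  rintro ⟨j, hjk, hj⟩
  exact (hR j k ((ZMod.intCast_eq_intCast_iff_dvd_sub _ _ _).1 hjk.symm)).1 hj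

theorem exists_reflection_of_periodic_three {R : ℤ → Prop}
    (hR : ∀ i j : ℤ, (3 : ℤ) ∣ i - j → (R i ↔ R j)) : ∃ d : ℤ, ∀ k, R k → R (d - k) := by
  obtain ⟨p, hp⟩ := exists_intCast_pred (q := 3) hR
  obtain ⟨c, hc⟩ := exists_reflection_zmod_three p
  obtain ⟨d, rfl⟩ := ZMod.intCast_surjective c
  refine ⟨d, fun k hk => ?_⟩
  rw [← hp] at hk ⊢
  exact_mod_cast hc k hk

theorem exists_reflection_of_periodic_four {R : ℤ → Prop}
    (hR : ∀ i j : ℤ, (4 : ℤ) ∣ i - j → (R i ↔ R j)) :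
    (∃ d : ℤ, ∀ k, R k → R (2 * d - k)) ∨
      ∃ s : ℤ, ∀ k, R k ↔ (4 : ℤ) ∣ k - s ∨ (4 : ℤ) ∣ k - (s + 1) := by
  obtain ⟨p, hp⟩ := exists_intCast_pred (q := 4) hR
  obtain ⟨c, hc⟩ | ⟨c, hc⟩ := exists_reflection_zmod_four p
  · obtain ⟨d, rfl⟩ := ZMod.intCast_surjective c
    refine .inl ⟨d, fun k hk => ?_⟩
    rw [← hp] at hk ⊢
    exact_mod_cast hc k hk
  · obtain ⟨s, rfl⟩ := ZMod.intCast_surjective c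
    refine .inr ⟨s, fun k => ?_⟩
    rw [← hp, hc]
    refine or_congr ?_ ?_
    · rw [eq_comm, ZMod.intCast_eq_intCast_iff_dvd_sub]
      rfl
    · rw [eq_comm]
      exact_mod_cast ZMod.intCast_eq_intCast_iff_dvd_sub (s + 1) k 4

/-- The orbits of size divisible by three cannot consist of just an orbit of size three and
another orbit. -/
theorem exists_third_orbit_of_ncard_eq_three [Finite P]
    (hgen : ∀ φ : P ≃o P, ∃ m : ℤ, g ^ m = φ) (hyx : y ∉ orbit g x)
    (hx : (orbit g x).ncard = 3) (hy : 3 ∣ (orbit g y).ncard) (hy9 : ¬ 9 ∣ (orbit g y).ncard) :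
    ∃ v ∉ orbit g x, v ∉ orbit g y ∧ 3 ∣ (orbit g v).ncard := by
  by_contra! hother
  obtain ⟨b, hb⟩ := hy
  have hcop : ∀ v ∉ orbit g x, v ∉ orbit g y → Nat.Coprime 3 (orbit g v).ncard :=
    fun v h1 h2 => (Nat.Prime.coprime_iff_not_dvd Nat.prime_three).2 (hother v h1 h2)
  have hgcd : (Nat.gcd (orbit g y).ncard (orbit g x).ncard : ℤ) ∣ 3 := by
    rw [hx]
    exact_mod_cast Nat.gcd_dvd_right ..
  have hb1 : (3 : ℤ) ∣ 1 - (b : ℤ) ^ 2 := by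
    have : ¬ 3 ∣ b := fun ⟨c, hc⟩ => hy9 ⟨c, by omega⟩
    obtain h | h : (b : ℤ) % 3 = 1 ∨ (b : ℤ) % 3 = 2 := by omega
    all_goals
      apply Int.dvd_of_emod_eq_zero
      simp [Int.sub_emod, pow_two, Int.mul_emod, h]
  obtain ⟨t, ht⟩ := hb1
  obtain ⟨d, hd1, hd2⟩ : ∃ d : ℤ, (∀ k, x ≤ (g ^ k) y → x ≤ (g ^ (d - k)) y) ∧
      ∀ k, (g ^ k) y ≤ x → (g ^ (d - k)) y ≤ x := by
    by_cases h : ∃ i : ℤ, (g ^ i) y ≤ x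
    · obtain ⟨i, hi⟩ := h
      obtain ⟨d, hd⟩ := exists_reflection_of_periodic_three (R := fun k => (g ^ k) y ≤ x)
        fun i j hij => zpow_le_iff_of_gcd_dvd x (hgcd.trans hij)
      exact ⟨d, fun k hk => absurd hk (not_le_zpow_of_zpow_le hyx hi k), hd⟩
    · obtain ⟨d, hd⟩ := exists_reflection_of_periodic_three (R := fun k => x ≤ (g ^ k) y)
        fun i j hij => le_zpow_iff_of_gcd_dvd x (hgcd.trans hij)
      exact ⟨d, hd, fun k hk => absurd ⟨k, hk⟩ h⟩
  have hgx : ∀ v ∉ orbit g x, v ∉ orbit g y → ∀ i : ℤ,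
      (Nat.gcd (orbit g x).ncard (orbit g v).ncard : ℤ) ∣ i := by
    intro v h1 h2 i
    rw [hx, hcop v h1 h2]
    exact_mod_cast one_dvd i
  have hgy : ∀ v ∉ orbit g x, v ∉ orbit g y → ∀ i j : ℤ,
      (Nat.gcd (orbit g y).ncard (orbit g v).ncard : ℤ) ∣ i - (i + (b : ℤ) ^ 2 * j) := by
    intro v h1 h2 i j
    rw [hb, (hcop v h1 h2).gcd_mul_left_cancel b]
    refine (Int.natCast_dvd_natCast.2 (Nat.gcd_dvd_left b (orbit g v).ncard)).trans ?_
    exact ⟨-(b * j), by ring⟩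
  refine false_of_reflection hgen hyx hx.ge (c := 0) (d := d) (e := (b : ℤ) ^ 2)
    ⟨b * t, by rw [hb]; push_cast; linear_combination (b : ℤ) ^ 2 * ht⟩
    (fun v h1 h2 i => ⟨(zpow_le_iff_of_gcd_dvd v (hgx v h1 h2 _)).1,
      (le_zpow_iff_of_gcd_dvd v (hgx v h1 h2 _)).1⟩)
    (fun v h1 h2 i => ⟨(zpow_le_iff_of_gcd_dvd v (hgy v h1 h2 _ _)).1,
      (le_zpow_iff_of_gcd_dvd v (hgy v h1 h2 _ _)).1⟩)
    fun i j => ⟨fun h => ?_, fun h => ?_⟩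
  · rw [zpow_le_zpow_iff_sub] at h ⊢
    refine (le_zpow_iff_of_gcd_dvd x (hgcd.trans ⟨t * (d - 2 * j), ?_⟩)).1 (hd1 _ h)
    linear_combination (d - 2 * j) * ht
  · rw [← zpow_le_zpow_iff g (-i), ← zpow_add_apply, ← zpow_add_apply, neg_add_cancel, zpow_zero,
      RelIso.one_apply] at h
    rw [← zpow_le_zpow_iff g i, ← zpow_add_apply, ← zpow_add_apply, zero_sub, add_neg_cancel,
      zpow_zero, RelIso.one_apply]
    refine (zpow_le_iff_of_gcd_dvd x (hgcd.trans ⟨t * (d - 2 * j), ?_⟩)).1 (hd2 _ h)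
    linear_combination (d - 2 * j) * ht

/-- Comparability of `v` with the points of the orbit of `x` does not depend on the point. -/
def UniformlyRelated (g : P ≃o P) (x v : P) : Prop :=
  ∀ i j : ℤ, ((g ^ i) x ≤ v ↔ (g ^ j) x ≤ v) ∧ (v ≤ (g ^ i) x ↔ v ≤ (g ^ j) x)

theorem UniformlyRelated.of_zpow {v : P} {k : ℤ} (h : UniformlyRelated g x ((g ^ k) v)) :
    UniformlyRelated g x v := by
  intro i j
  have := h (k + i) (k + j)
  simpa only [zpow_add_apply, zpow_le_zpow_iff] using this

/-- If `x` lies below two consecutive points of the orbit of `y`, both orbits having size four, then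
by transitivity no orbit of size not divisible by four relates to both nontrivially. -/
theorem uniformlyRelated_or_of_consecutive (hno : ∀ i j : ℤ, ¬ (g ^ i) y ≤ (g ^ j) x) {s : ℤ}
    (hs : ∀ k : ℤ, x ≤ (g ^ k) y ↔ (4 : ℤ) ∣ k - s ∨ (4 : ℤ) ∣ k - (s + 1)) {v : P}
    (hy : ∀ i j : ℤ, (2 : ℤ) ∣ i - j →
      ((g ^ i) y ≤ v ↔ (g ^ j) y ≤ v) ∧ (v ≤ (g ^ i) y ↔ v ≤ (g ^ j) y)) :
    UniformlyRelated g x v ∨ UniformlyRelated g y v := by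
  have hle : ∀ i j : ℤ, ∃ k, (2 : ℤ) ∣ k - j ∧ (g ^ i) x ≤ (g ^ k) y := by
    intro i j
    simp only [zpow_le_zpow_iff_sub, hs]
    obtain ⟨m, h | h⟩ := Int.even_or_odd' (i + s - j)
    · exact ⟨i + s, by omega, .inl (by simp)⟩
    · exact ⟨i + s + 1, by omega, .inr (by ring_nf; simp)⟩
  by_cases h1 : ∃ k : ℤ, v ≤ (g ^ k) x
  · obtain ⟨k, hk⟩ := h1
    have hv : ∀ j : ℤ, v ≤ (g ^ j) y := fun j =>
      let ⟨m, hm, hkm⟩ := hle k j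
      (hy m j hm).2.1 (hk.trans hkm)
    have hv' : ∀ j : ℤ, ¬ (g ^ j) y ≤ v := fun j hj => hno j k (hj.trans hk)
    exact .inr fun i j => by simp [hv, hv']
  by_cases h2 : ∃ k : ℤ, (g ^ k) y ≤ v
  · obtain ⟨k, hk⟩ := h2
    have hv : ∀ j : ℤ, (g ^ j) x ≤ v := fun j =>
      let ⟨m, hm, hkm⟩ := hle j k
      hkm.trans ((hy m k hm).1.2 hk)
    push Not at h1
    exact .inl fun i j => by simp [hv, h1]
  push Not at h1 h2
  by_cases h3 : ∃ i : ℤ, (g ^ i) x ≤ v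
  · obtain ⟨i, hi⟩ := h3
    have h4 : ∀ j : ℤ, ¬ v ≤ (g ^ j) y := by
      intro j hj
      have h5 := hi.trans hj
      have h6 := hi.trans ((hy (j + 2) j (by simp)).2.2 hj)
      rw [zpow_le_zpow_iff_sub, hs] at h5 h6
      omega
    exact .inr fun i j => by simp [h2, h4]
  · push Not at h3
    exact .inl fun i j => by simp [h1, h3]

theorem false_of_two_orbits_of_ncard_four_of_not_le [Finite P]
    (hgen : ∀ φ : P ≃o P, ∃ m : ℤ, g ^ m = φ) (hyx : y ∉ orbit g x)
    (hx : (orbit g x).ncard = 4) (hy : (orbit g y).ncard = 4)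
    (h4 : ∀ v ∉ orbit g x, v ∉ orbit g y → ¬ 4 ∣ (orbit g v).ncard)
    (h2 : ∀ v ∉ orbit g x, v ∉ orbit g y → ∀ v' ∉ orbit g x, v' ∉ orbit g y →
      2 ∣ (orbit g v).ncard → 2 ∣ (orbit g v').ncard → v' ∈ orbit g v)
    (hno : ∀ k : ℤ, ¬ (g ^ k) y ≤ x) : False := by
  have hno' : ∀ i j : ℤ, ¬ (g ^ i) y ≤ (g ^ j) x := by
    intro i j
    rw [← zpow_le_zpow_iff g (-j), ← zpow_add_apply, ← zpow_add_apply, neg_add_cancel, zpow_zero,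
      RelIso.one_apply]
    exact hno _
  have hper : ∀ {z : P}, (orbit g z).ncard = 4 → ∀ v ∉ orbit g x, v ∉ orbit g y → ∀ i j : ℤ,
      (2 : ℤ) ∣ i - j →
      ((g ^ i) z ≤ v ↔ (g ^ j) z ≤ v) ∧ (v ≤ (g ^ i) z ↔ v ≤ (g ^ j) z) := by
    intro z hz v hvx hvy i j hij
    have hd : (Nat.gcd (orbit g z).ncard (orbit g v).ncard : ℤ) ∣ i - j := by
      refine dvd_trans ?_ hij
      have := dvd_div_of_not_dvd (r := 2) Nat.prime_two (by norm_num)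
        (Nat.gcd_dvd_left 4 (orbit g v).ncard)
        fun h => h4 v hvx hvy (h.trans (Nat.gcd_dvd_right ..))
      rw [hz]
      exact_mod_cast this
    exact ⟨zpow_le_iff_of_gcd_dvd v hd, le_zpow_iff_of_gcd_dvd v hd⟩
  have hodd : ∀ {z : P}, (orbit g z).ncard = 4 → ∀ v, ¬ 2 ∣ (orbit g v).ncard →
      UniformlyRelated g z v := by
    intro z hz v hv i j
    have hd : (Nat.gcd (orbit g z).ncard (orbit g v).ncard : ℤ) ∣ i - j := by
      rw [hz, ((Nat.Prime.coprime_iff_not_dvd Nat.prime_two).2 hv).pow_left 2]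
      exact_mod_cast one_dvd _
    exact ⟨zpow_le_iff_of_gcd_dvd v hd, le_zpow_iff_of_gcd_dvd v hd⟩
  have hself : ∀ i j : ℤ, (4 : ℤ) ∣ i - j → (x ≤ (g ^ i) y ↔ x ≤ (g ^ j) y) := by
    intro i j hij
    refine le_zpow_iff_of_gcd_dvd x ?_
    rwa [hx, hy]
  have hreflect : ∀ c d : ℤ,
      (∀ v ∉ orbit g x, v ∉ orbit g y → (2 : ℤ) ∣ c ∨ UniformlyRelated g x v) →
      (∀ v ∉ orbit g x, v ∉ orbit g y → (2 : ℤ) ∣ d ∨ UniformlyRelated g y v) →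
      (∀ k, x ≤ (g ^ k) y → x ≤ (g ^ (d - c - k)) y) → False := by
    intro c d hc hd hcd
    refine false_of_reflection hgen hyx (by omega) (c := c) (d := d) (e := 1) (by simp)
      (fun v h1 h2 i => ?_) (fun v h1 h2 i => ?_)
      fun i j => ⟨fun h => ?_, fun h => absurd h (hno' _ _)⟩
    · obtain h | h := hc v h1 h2
      · have := hper hx v h1 h2 i (c - i) (by omega)
        exact ⟨this.1.1, this.2.1⟩
      · exact ⟨(h _ _).1.1, (h _ _).2.1⟩
    · obtain h | h := hd v h1 h2
      · have := hper hy v h1 h2 i (i + 1 * (d - 2 * i)) (by omega)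
        exact ⟨this.1.1, this.2.1⟩
      · exact ⟨(h _ _).1.1, (h _ _).2.1⟩
    · rw [zpow_le_zpow_iff_sub] at h ⊢
      convert hcd _ h using 3
      ring
  obtain ⟨d, hd⟩ | ⟨s, hs⟩ := exists_reflection_of_periodic_four hself
  · exact hreflect 0 (2 * d) (fun _ _ _ => .inl (by simp)) (fun _ _ _ => .inl (by simp))
      (by simpa using hd)
  · by_cases hux : ∀ v ∉ orbit g x, v ∉ orbit g y → UniformlyRelated g x v
    · refine hreflect (-1) (2 * s) (fun v h1 h2 => .inr (hux v h1 h2))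
        (fun _ _ _ => .inl (by simp)) fun k hk => ?_
      rw [hs] at hk ⊢
      omega
    · push Not at hux
      obtain ⟨v, hvx, hvy, hv⟩ := hux
      refine hreflect 0 (2 * s + 1) (fun _ _ _ => .inl (by simp)) (fun v' hvx' hvy' => .inr ?_)
        fun k hk => ?_
      · by_cases hv' : 2 ∣ (orbit g v').ncard
        · refine (uniformlyRelated_or_of_consecutive hno' hs
            (hper hy v' hvx' hvy')).resolve_left fun hu => hv ?_
          obtain ⟨k, rfl⟩ := h2 v hvx hvy v' hvx' hvy' (not_not.1 fun h => hv (hodd hx v h)) hv'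
          exact hu.of_zpow
        · exact hodd hy v' hv'
      · rw [hs] at hk ⊢
        omega

/-- If the orbits of size divisible by four are just two orbits of size four, then there are at
least two further orbits of even size. -/
theorem exists_even_orbits_of_ncard_four [Finite P]
    (hgen : ∀ φ : P ≃o P, ∃ m : ℤ, g ^ m = φ) (hyx : y ∉ orbit g x)
    (hx : (orbit g x).ncard = 4) (hy : (orbit g y).ncard = 4)
    (h4 : ∀ v ∉ orbit g x, v ∉ orbit g y → ¬ 4 ∣ (orbit g v).ncard) :
    ∃ v v', v ∉ orbit g x ∧ v ∉ orbit g y ∧ v' ∉ orbit g x ∧ v' ∉ orbit g y ∧ v' ∉ orbit g v ∧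
      2 ∣ (orbit g v).ncard ∧ 2 ∣ (orbit g v').ncard := by
  by_contra! h
  by_cases hno : ∃ k : ℤ, (g ^ k) y ≤ x
  · obtain ⟨k, hk⟩ := hno
    refine false_of_two_orbits_of_ncard_four_of_not_le hgen (mt mem_orbit_comm.1 hyx) hy hx
      (fun v h1 h2 => h4 v h2 h1) (fun v h1 h2 v' h1' h2' he he' => ?_) fun m hm => ?_
    · by_contra hvv
      exact h v v' h2 h1 h2' h1' hvv he he'
    · exact not_le_zpow_of_zpow_le hyx hk (-m) ((zpow_le_iff g m x y).1 hm)
  · push Not at hno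
    refine false_of_two_orbits_of_ncard_four_of_not_le hgen hyx hx hy h4
      (fun v h1 h2 v' h1' h2' he he' => ?_) hno
    by_contra hvv
    exact h v v' h1 h2 h1' h2' hvv he he'

end Orbits

theorem one_add_mul_card_primeFactors_le {m c : ℕ} (hm : m ≠ 0)
    (hc : ∀ p ∈ m.primeFactors, c + 1 ≤ p) : 1 + m.primeFactors.card * c ≤ m :=
  calc 1 + m.primeFactors.card * c ≤ (1 + c) ^ m.primeFactors.card :=
        one_add_mul_le_pow_of_sq_nonneg (Nat.zero_le _) (Nat.zero_le _) (Nat.zero_le _) _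
    _ = (c + 1) ^ m.primeFactors.card := by rw [add_comm]
    _ ≤ ∏ p ∈ m.primeFactors, p := Finset.pow_card_le_prod _ _ _ hc
    _ ≤ m := Nat.le_of_dvd (Nat.pos_of_ne_zero hm) (Nat.prod_primeFactors_dvd m)

theorem one_add_card_primeFactors_le {m : ℕ} (hm : m ≠ 0) : 1 + m.primeFactors.card ≤ m := by
  simpa using one_add_mul_card_primeFactors_le (c := 1) hm
    fun p hp => (Nat.prime_of_mem_primeFactors hp).two_le

theorem one_add_four_mul_card_primeFactors_le {m : ℕ} (hm : m ≠ 0) (h2 : ¬ 2 ∣ m) (h3 : ¬ 3 ∣ m) :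
    1 + m.primeFactors.card * 4 ≤ m := by
  refine one_add_mul_card_primeFactors_le hm fun p hp => ?_
  have hpm := Nat.dvd_of_mem_primeFactors hp
  have hp := Nat.prime_of_mem_primeFactors hp
  by_contra! hlt
  have h0 := hp.two_le
  interval_cases p
  · exact h2 hpm
  · exact h3 hpm
  · revert hp
    decide

theorem card_primeFactors_pow_mul {p r m : ℕ} (hp : p.Prime) (hr : r ≠ 0) (hm : ¬ p ∣ m) :
    (p ^ r * m).primeFactors.card = 1 + m.primeFactors.card := by
  have hcop : Nat.Coprime (p ^ r) m := ((Nat.Prime.coprime_iff_not_dvd hp).2 hm).pow_left r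
  rw [hcop.primeFactors_mul, Finset.card_union_of_disjoint hcop.disjoint_primeFactors,
    Nat.primeFactors_prime_pow hr hp, Finset.card_singleton]

section Weights

variable {n l : ℕ}

theorem exactDvd_two_iff : ExactDvd 2 n ↔ 2 ∣ n ∧ ¬ 4 ∣ n := by
  simp [ExactDvd, Nat.prime_two.minFac_eq]

theorem exactDvd_three_iff : ExactDvd 3 n ↔ 3 ∣ n ∧ ¬ 9 ∣ n := by
  simp [ExactDvd, Nat.prime_three.minFac_eq]

theorem exactDvd_four_iff : ExactDvd 4 n ↔ 4 ∣ n ∧ ¬ 8 ∣ n := by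
  have : Nat.minFac 4 = 2 := by norm_num
  simp [ExactDvd, this]

/-- The contribution `4 w₄ + 3 w₃` of a cycle of length `l`. -/
noncomputable def contribution (n l : ℕ) : ℚ := 4 * w n l 4 + 3 * w n l 3

theorem contribution_eq (h4 : 4 ∣ n) (hl8 : ¬ 8 ∣ l) (hl9 : ¬ 9 ∣ l)
    (h6 : l ≠ 6) (h12 : l ≠ 12) (h10 : l ≠ 10) (h14 : l ≠ 14) :
    contribution n l = (if 2 ∣ l then (l : ℚ) / l.primeFactors.card else 0) +
      if 3 ∣ l then (l : ℚ) / l.primeFactors.card else 0 := by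
  have hp3 : IsPrimePow 3 := Nat.prime_three.isPrimePow
  have hp4 : IsPrimePow 4 := (isPrimePow_nat_iff 4).2 ⟨2, 2, Nat.prime_two, by norm_num, rfl⟩
  rw [contribution, w, w]
  simp only [h6, h12, h10, h14, if_false, exactDvd_two_iff, exactDvd_three_iff, exactDvd_four_iff,
    hp3, hp4, h4, hl8, hl9]
  congr 1
  · by_cases h4l : 4 ∣ l
    · have h2l : 2 ∣ l := dvd_trans (by norm_num) h4l
      simp only [h4l, h2l]
      norm_num
      ring
    · by_cases h2l : 2 ∣ l
      · simp only [h4l, h2l]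
        norm_num
        ring
      · simp [h4l, h2l]
  · by_cases h3l : 3 ∣ l
    · simp only [h3l]
      norm_num
      ring
    · simp [h3l]

theorem contribution_six (h3 : ExactDvd 3 n) : contribution n 6 = 6 := by
  norm_num [contribution, w, h3]

theorem contribution_twelve (h3 : ExactDvd 3 n) : contribution n 12 = 12 := by
  norm_num [contribution, w, h3]

theorem contribution_ten (h4 : 4 ∣ n) : contribution n 10 = 2 := by
  norm_num [contribution, w, exactDvd_two_iff, h4]

theorem contribution_fourteen (h4 : 4 ∣ n) : contribution n 14 = 2 := by
  norm_num [contribution, w, exactDvd_two_iff, h4]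

theorem contribution_nonneg (n l : ℕ) : 0 ≤ contribution n l := by
  unfold contribution w
  split_ifs <;> positivity

/-- Lower bounds for `4 w₄ + 3 w₃` in terms of divisibility of the cycle length. -/
theorem le_contribution (h3 : ExactDvd 3 n) (h4 : ExactDvd 4 n) (hln : l ∣ n) (hl0 : l ≠ 0) :
    (2 ∣ l → 2 ≤ contribution n l) ∧ (4 ∣ l → 4 ≤ contribution n l) ∧
    (4 ∣ l → l ≠ 4 → 7 ≤ contribution n l) ∧ (3 ∣ l → 3 ≤ contribution n l) ∧
    (3 ∣ l → l ≠ 3 → 6 ≤ contribution n l) ∧ (3 ∣ l → 4 ∣ l → 12 ≤ contribution n l) := by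
  obtain ⟨h4n, h8n⟩ := exactDvd_four_iff.1 h4
  have h9n := (exactDvd_three_iff.1 h3).2
  by_cases h6 : l = 6
  · subst h6
    norm_num [contribution_six h3]
  by_cases h12 : l = 12
  · subst h12
    norm_num [contribution_twelve h3]
  by_cases h10 : l = 10
  · subst h10
    norm_num [contribution_ten h4n]
  by_cases h14 : l = 14
  · subst h14
    norm_num [contribution_fourteen h4n]
  have h8 : ¬ 8 ∣ l := fun h => h8n (h.trans hln)
  have h9 : ¬ 9 ∣ l := fun h => h9n (h.trans hln)
  rw [contribution_eq h4n h8 h9 h6 h12 h10 h14]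
  by_cases hl1 : l = 1
  · subst hl1
    norm_num
  have hk : 0 < l.primeFactors.card := by
    rw [Finset.card_pos, Nat.nonempty_primeFactors]
    omega
  have hbound : ∀ a : ℕ, a * l.primeFactors.card ≤ l → (a : ℚ) ≤ l / l.primeFactors.card := by
    intro a ha
    rw [le_div_iff₀ (by exact_mod_cast hk)]
    exact_mod_cast ha
  by_cases h3l : 3 ∣ l
  · obtain ⟨m, rfl⟩ := h3l
    have h3m : ¬ 3 ∣ m := fun ⟨c, hc⟩ => h9 ⟨c, by omega⟩
    have hm0 : m ≠ 0 := by omega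
    have hcard := card_primeFactors_pow_mul (r := 1) Nat.prime_three one_ne_zero h3m
    rw [pow_one] at hcard
    by_cases h2m : 2 ∣ m
    · have h2l : 2 ∣ 3 * m := dvd_mul_of_dvd_right h2m 3
      have hb := hbound 3 (by
        have := one_add_card_primeFactors_le hm0
        omega)
      have hb' : 4 ∣ 3 * m → _ := fun h4l => hbound 6 (by
        obtain ⟨k, rfl⟩ : 4 ∣ m := by omega
        have h2k : ¬ 2 ∣ k := fun ⟨c, hc⟩ => h8 ⟨3 * c, by omega⟩
        have hcard' := card_primeFactors_pow_mul (r := 2) Nat.prime_two two_ne_zero h2k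
        have := one_add_card_primeFactors_le (m := k) (by omega)
        norm_num at hcard'
        omega)
      simp only [h2l, dvd_mul_right, if_true]
      norm_num at hb hb' ⊢
      exact ⟨by linarith, fun h => by linarith [hb' h], fun h _ => by linarith [hb' h],
        by linarith, fun _ => by linarith, fun h => by linarith [hb' h]⟩
    · have h2l : ¬ 2 ∣ 3 * m := by omega
      have h4l : ¬ 4 ∣ 3 * m := by omega
      have hm := one_add_four_mul_card_primeFactors_le hm0 h2m h3m
      have hb := hbound 3 (by omega)
      have hb' : 3 * m ≠ 3 → _ := fun h => hbound 6 (by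
        have : m.primeFactors.card ≠ 0 := by
          rw [Finset.card_ne_zero, Nat.nonempty_primeFactors]
          omega
        omega)
      simp only [h2l, h4l, dvd_mul_right, if_true, if_false, zero_add]
      norm_num at hb hb' ⊢
      exact ⟨hb, hb'⟩
  · by_cases h4l : 4 ∣ l
    · obtain ⟨m, rfl⟩ := h4l
      have h2m : ¬ 2 ∣ m := fun ⟨c, hc⟩ => h8 ⟨c, by omega⟩
      have hcard := card_primeFactors_pow_mul (r := 2) Nat.prime_two two_ne_zero h2m
      norm_num at hcard
      have hm := one_add_four_mul_card_primeFactors_le (m := m) (by omega) h2m (by omega)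
      have hb := hbound 4 (by omega)
      have hb' : 4 * m ≠ 4 → _ := fun h => hbound 7 (by
        have : m.primeFactors.card ≠ 0 := by
          rw [Finset.card_ne_zero, Nat.nonempty_primeFactors]
          omega
        omega)
      have h2l : 2 ∣ 4 * m := by omega
      simp only [h2l, h3l, dvd_mul_right, if_true, if_false, add_zero]
      norm_num at hb hb' ⊢
      exact ⟨by linarith, hb, hb'⟩
    · simp only [h3l, h4l, false_imp_iff, and_true, if_false, add_zero]
      intro h2l
      rw [if_pos h2l]
      obtain ⟨m, rfl⟩ := h2l
      have h2m : ¬ 2 ∣ m := fun ⟨c, hc⟩ => h4l ⟨c, by omega⟩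
      have hcard := card_primeFactors_pow_mul (r := 1) Nat.prime_two one_ne_zero h2m
      rw [pow_one] at hcard
      have := one_add_card_primeFactors_le (m := m) (by omega)
      exact_mod_cast hbound 2 (by omega)

end Weights

theorem sum_contribution_le {P : Type} [PartialOrder P] [Finite P] (g : P ≃o P) (n : ℕ)
    (L : List P) (hL : ∀ v ∈ L, 2 ≤ (orbit g v).ncard)
    (hne : L.Pairwise fun u v => orbit g u ≠ orbit g v) :
    (L.map fun v => contribution n (orbit g v).ncard).sum ≤
      ∑ᶠ A ∈ cycles g, (4 * w n A.ncard 4 + 3 * w n A.ncard 3) := by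
  have hfin : (cycles g).Finite := Set.toFinite _
  have hnd : (L.map (orbit g)).Nodup := List.pairwise_map.2 hne
  rw [finsum_mem_eq_finite_toFinset_sum _ hfin]
  calc (L.map fun v => contribution n (orbit g v).ncard).sum
      = ∑ A ∈ (L.map (orbit g)).toFinset, contribution n A.ncard := by
        rw [List.sum_toFinset _ hnd, List.map_map]
        rfl
    _ ≤ _ := Finset.sum_le_sum_of_subset_of_nonneg (fun A hA => ?_)
        fun A _ _ => contribution_nonneg n A.ncard
  obtain ⟨v, hv, rfl⟩ := List.mem_map.1 (List.mem_toFinset.1 hA)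
  exact hfin.mem_toFinset.2 ⟨⟨v, rfl⟩, hL v hv⟩

/-- (Theorem 4.1, last case.) Let `P` be a finite poset with `Aut(P)` cyclic of order
`n ≥ 1` generated by `g`. If `3 ∥ n` and `4 ∥ n` then
`Σ_{α ∈ g} (4·w₄(α) + 3·w₃(α)) ≥ 20`. -/
theorem weight_sum_three_four (n : ℕ) (hn : 1 ≤ n)
    (P : Type) [PartialOrder P] [Fintype P] (g : P ≃o P)
    (hord : orderOf g = n) (hgen : ∀ φ : P ≃o P, ∃ m : ℤ, g ^ m = φ)
    (h3 : ExactDvd 3 n) (h4 : ExactDvd 4 n) :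
    (20 : ℚ) ≤ ∑ᶠ A ∈ cycles g, (4 * w n A.ncard 4 + 3 * w n A.ncard 3) := by
 
  subst hord
  have hpos : 0 < orderOf g := hn
  by_contra! hlt
  set F : P → ℚ := fun v => contribution (orderOf g) (orbit g v).ncard
  have hle : ∀ v, _ := fun v => le_contribution h3 h4 (ncard_orbit_dvd_orderOf g v)
    (ncard_orbit_pos g v).ne'
  have htwo : ∀ {q : ℕ} {v : P}, 2 ≤ q → q ∣ (orbit g v).ncard → 2 ≤ (orbit g v).ncard :=
    fun hq h => hq.trans (Nat.le_of_dvd (ncard_orbit_pos g _) h)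
  have htwo2 : ∀ {v : P}, 2 ∣ (orbit g v).ncard → 2 ≤ (orbit g v).ncard := htwo (by norm_num)
  have htwo3 : ∀ {v : P}, 3 ∣ (orbit g v).ncard → 2 ≤ (orbit g v).ncard := htwo (by norm_num)
  have htwo4 : ∀ {v : P}, 4 ∣ (orbit g v).ncard → 2 ≤ (orbit g v).ncard := htwo (by norm_num)
  have hsum : ∀ L : List P, (∀ v ∈ L, 2 ≤ (orbit g v).ncard) →
      (L.Pairwise fun u v => orbit g u ≠ orbit g v) → (L.map F).sum < 20 :=
    fun L h1 h2 => (sum_contribution_le g _ L h1 h2).trans_lt hlt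
  have orbit_ne : ∀ {u v : P}, u ∉ orbit g v → orbit g u ≠ orbit g v := fun h h' =>
    h (orbit_eq_iff.1 h')
  have hthird : ∀ {x y : P}, orbit g y ≠ orbit g x → (orbit g x).ncard = 3 →
      3 ∣ (orbit g y).ncard →
      ∃ v, orbit g v ≠ orbit g x ∧ orbit g v ≠ orbit g y ∧ 3 ∣ (orbit g v).ncard := by
    intro x y hyx hx hy
    obtain ⟨v, hvx, hvy, hv⟩ := exists_third_orbit_of_ncard_eq_three hgen
      (mt orbit_eq_iff.2 hyx) hx hy
      fun h => (exactDvd_three_iff.1 h3).2 (h.trans (ncard_orbit_dvd_orderOf g y))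
    exact ⟨v, orbit_ne hvx, orbit_ne hvy, hv⟩
  have hnot12 : ∀ x : P, 4 ∣ (orbit g x).ncard → ¬ 3 ∣ (orbit g x).ncard := by
    intro x hx4 hx3
    obtain ⟨y, hyx, hy⟩ : ∃ y ∉ orbit g x, 4 ∣ (orbit g y).ncard :=
      exists_not_mem_orbit_dvd_ncard (r := 2) hgen Nat.prime_two (by norm_num) hx4
    obtain ⟨z, hzx, hz⟩ : ∃ z ∉ orbit g x, 3 ∣ (orbit g z).ncard :=
      exists_not_mem_orbit_dvd_ncard (r := 1) hgen Nat.prime_three (by norm_num) hx3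
    replace hyx := orbit_ne hyx
    replace hzx := orbit_ne hzx
    have hFx : 12 ≤ F x := (hle x).2.2.2.2.2 hx3 hx4
    have hFy : 4 ≤ F y := (hle y).2.1 hy
    have hy3 : ¬ 3 ∣ (orbit g y).ncard := fun h => by
      have hFy' : 12 ≤ F y := (hle y).2.2.2.2.2 h hy
      have := hsum [x, y] (by simp [htwo4 hx4, htwo4 hy]) (by simp [hyx.symm])
      norm_num at this
      linarith
    have hne : ∀ {v}, 3 ∣ (orbit g v).ncard → orbit g v ≠ orbit g y := fun h h' =>
      hy3 (h' ▸ h)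
    have hz3 : (orbit g z).ncard = 3 := by
      by_contra h
      have hFz : 6 ≤ F z := (hle z).2.2.2.2.1 hz h
      have := hsum [x, y, z] (by simp [htwo4 hx4, htwo4 hy, htwo3 hz])
        (by simp [hyx.symm, hzx.symm, (hne hz).symm])
      norm_num at this
      linarith
    obtain ⟨v, hvz, hvx, hv⟩ := hthird hzx.symm hz3 hx3
    have hFz : 3 ≤ F z := (hle z).2.2.2.1 hz
    have hFv : 3 ≤ F v := (hle v).2.2.2.1 hv
    have := hsum [x, y, z, v] (by simp [htwo4 hx4, htwo4 hy, htwo3 hz, htwo3 hv])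
      (by simp [hyx.symm, hzx.symm, (hne hz).symm, (hne hv).symm, hvx.symm, hvz.symm])
    norm_num at this
    linarith
  obtain ⟨x, hx⟩ : ∃ x : P, 4 ∣ (orbit g x).ncard :=
    exists_dvd_ncard_orbit (r := 2) Nat.prime_two two_ne_zero h4.1 hpos
  obtain ⟨y, hyx, hy⟩ : ∃ y ∉ orbit g x, 4 ∣ (orbit g y).ncard :=
    exists_not_mem_orbit_dvd_ncard (r := 2) hgen Nat.prime_two (by norm_num) hx
  obtain ⟨a, ha⟩ : ∃ a : P, 3 ∣ (orbit g a).ncard :=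
    exists_dvd_ncard_orbit (r := 1) Nat.prime_three one_ne_zero h3.1 hpos
  obtain ⟨b, hba, hb⟩ : ∃ b ∉ orbit g a, 3 ∣ (orbit g b).ncard :=
    exists_not_mem_orbit_dvd_ncard (r := 1) hgen Nat.prime_three (by norm_num) ha
  have hyx' := orbit_ne hyx
  replace hba := orbit_ne hba
  have hne : ∀ {u v : P}, 4 ∣ (orbit g u).ncard → 3 ∣ (orbit g v).ncard →
      orbit g u ≠ orbit g v := fun hu hv h => hnot12 _ hu (h ▸ hv)
  have hF4 : ∀ {v}, 4 ∣ (orbit g v).ncard → 4 ≤ F v := fun h => (hle _).2.1 h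
  have hF3 : ∀ {v}, 3 ∣ (orbit g v).ncard → 3 ≤ F v := fun h => (hle _).2.2.2.1 h
  have hF3' : ∀ {v}, 3 ∣ (orbit g v).ncard → (orbit g v).ncard ≠ 3 → 6 ≤ F v :=
    fun h h' => (hle _).2.2.2.2.1 h h'
  obtain ⟨c, hca, hcb, hc⟩ : ∃ c, orbit g c ≠ orbit g a ∧ orbit g c ≠ orbit g b ∧
      3 ∣ (orbit g c).ncard := by
    by_cases ha3 : (orbit g a).ncard = 3
    · exact hthird hba ha3 hb
    by_cases hb3 : (orbit g b).ncard = 3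
    · obtain ⟨c, hcb, hca, hc⟩ := hthird hba.symm hb3 ha
      exact ⟨c, hca, hcb, hc⟩
    have := hsum [x, y, a, b] (by simp [htwo4 hx, htwo4 hy, htwo3 ha, htwo3 hb])
      (by simp [hyx'.symm, hba.symm, hne hx ha, hne hx hb, hne hy ha, hne hy hb])
    norm_num at this
    linarith [hF4 hx, hF4 hy, hF3' ha ha3, hF3' hb hb3]
  have hxyabc : ∀ L : List P, (∀ v ∈ L, 2 ∣ (orbit g v).ncard) →
      (∀ v ∈ L, orbit g v ≠ orbit g x ∧ orbit g v ≠ orbit g y ∧ orbit g v ≠ orbit g a ∧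
        orbit g v ≠ orbit g b ∧ orbit g v ≠ orbit g c) →
      (L.Pairwise fun u v => orbit g u ≠ orbit g v) →
      F x + (F y + (F a + (F b + (F c + (L.map F).sum)))) < 20 := by
    intro L h2 hL hL'
    have := hsum (x :: y :: a :: b :: c :: L)
      (by
        simp only [List.forall_mem_cons, htwo4 hx, htwo4 hy, htwo3 ha, htwo3 hb, htwo3 hc, true_and]
        exact fun v hv => htwo2 (h2 v hv))
      (by
        simp only [List.pairwise_cons, List.forall_mem_cons]
        refine ⟨⟨hyx'.symm, hne hx ha, hne hx hb, hne hx hc, fun v hv => (hL v hv).1.symm⟩,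
          ⟨hne hy ha, hne hy hb, hne hy hc, fun v hv => (hL v hv).2.1.symm⟩,
          ⟨hba.symm, hca.symm, fun v hv => (hL v hv).2.2.1.symm⟩,
          ⟨hcb.symm, fun v hv => (hL v hv).2.2.2.1.symm⟩,
          fun v hv => (hL v hv).2.2.2.2.symm, hL'⟩)
    simpa only [List.map_cons, List.sum_cons] using this
  have h0 := hxyabc [] (by simp) (by simp) (by simp)
  simp only [List.map_nil, List.sum_nil, add_zero] at h0
  have hx4 : (orbit g x).ncard = 4 := by
    by_contra h
    have hFx : 7 ≤ F x := (hle x).2.2.1 hx h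
    linarith [hF4 hy, hF3 ha, hF3 hb, hF3 hc]
  have hy4 : (orbit g y).ncard = 4 := by
    by_contra h
    have hFy : 7 ≤ F y := (hle y).2.2.1 hy h
    linarith [hF4 hx, hF3 ha, hF3 hb, hF3 hc]
  have ha3 : (orbit g a).ncard = 3 := by
    by_contra h
    linarith [hF4 hx, hF4 hy, hF3' ha h, hF3 hb, hF3 hc]
  have hb3 : (orbit g b).ncard = 3 := by
    by_contra h
    linarith [hF4 hx, hF4 hy, hF3 ha, hF3' hb h, hF3 hc]
  have hc3 : (orbit g c).ncard = 3 := by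
    by_contra h
    linarith [hF4 hx, hF4 hy, hF3 ha, hF3 hb, hF3' hc h]
  have hodd : ∀ {u v : P}, 2 ∣ (orbit g v).ncard → (orbit g u).ncard = 3 →
      orbit g v ≠ orbit g u := by
    intro u v hv hu h
    rw [h, hu] at hv
    omega
  obtain ⟨v, v', hvx, hvy, hvx', hvy', hvv', hv2, hv2'⟩ :=
    exists_even_orbits_of_ncard_four hgen hyx hx4 hy4 (by
      intro v hvx hvy hv
      have hv2 : 2 ∣ (orbit g v).ncard := dvd_trans (by norm_num) hv
      have h1 := hxyabc [v] (by simpa using hv2) (by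
        simpa using ⟨orbit_ne hvx, orbit_ne hvy, hodd hv2 ha3, hodd hv2 hb3, hodd hv2 hc3⟩)
        (by simp)
      simp only [List.map_cons, List.map_nil, List.sum_cons, List.sum_nil, add_zero] at h1
      linarith [hF4 hx, hF4 hy, hF3 ha, hF3 hb, hF3 hc, hF4 hv])
  have h2 := hxyabc [v, v'] (by simp [hv2, hv2'])
    (by
      simp only [List.forall_mem_cons]
      exact ⟨⟨orbit_ne hvx, orbit_ne hvy, hodd hv2 ha3, hodd hv2 hb3, hodd hv2 hc3⟩,
        ⟨orbit_ne hvx', orbit_ne hvy', hodd hv2' ha3, hodd hv2' hb3, hodd hv2' hc3⟩, by simp⟩)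
    (by simpa using (orbit_ne hvv').symm)
  simp only [List.map_cons, List.map_nil, List.sum_cons, List.sum_nil, add_zero] at h2
  have hFv : 2 ≤ F v := (hle v).1 hv2
  have hFv' : 2 ≤ F v' := (hle v').1 hv2'
  linarith [hF4 hx, hF4 hy, hF3 ha, hF3 hb, hF3 hc]
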